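/- arXiv:1411.4357 — 2 statements merged into one kernel-verified Lean document; each statement's English description precedes it below -/
import Mathlib

section
/- There is an absolute constant C > 0 with the following property. Let 0 < ε < 1 and 0 < δ < 1, let k ≥ C(d + log(1/δ))/ε², and let S be a random k×n real matrix whose entries are independent Gaussian random variables with mean 0 and variance 1/k (that is, S = (1/√k)·R with R a k×n matrix of i.i.d. standard normal random variables). Then for any fixed real n×d matrix A, with probability at least 1 − δ, simultaneously for all x ∈ ℝ^d it holds that (1 − ε)‖Ax‖₂ ≤ ‖SAx‖₂ ≤ (1 + ε)‖Ax‖₂. -/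
open MeasureTheory ProbabilityTheory Matrix
open scoped NNReal

/-- The Euclidean norm of a vector in `ℝ^n`. -/
noncomputable def euclNorm {n : ℕ} (x : Fin n → ℝ) : ℝ := Real.sqrt (∑ i, (x i) ^ 2)

lemma map_sum_mul_pi_gaussianReal {ι : Type*} [Fintype ι] (v : ℝ≥0) {y : ι → ℝ}
    (hy : ∑ j, y j ^ 2 = 1) :
    (Measure.pi fun _ : ι => gaussianReal 0 v).map (fun ω => ∑ j, ω j * y j) =
      gaussianReal 0 v := by
  have hm : ∀ j, Measurable fun ω : ι → ℝ => ω j * y j := by fun_prop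
  have hind : iIndepFun (fun j (ω : ι → ℝ) => ω j * y j)
      (Measure.pi fun _ : ι => gaussianReal 0 v) :=
    iIndepFun_pi (X := fun j (x : ℝ) => x * y j) (by fun_prop)
  have hlaw : ∀ j, (Measure.pi fun _ : ι => gaussianReal 0 v).map (fun ω => ω j * y j) =
      gaussianReal 0 (NNReal.mk (y j ^ 2) (sq_nonneg _) * v) := by
    intro j
    have h := gaussianReal_map_mul_const (μ := 0) (v := v) (y j)
    rw [mul_zero] at h
    rw [← h]
    nth_rewrite 2 [← (measurePreserving_eval (fun _ : ι => gaussianReal 0 v) j).map_eq]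
    rw [Measure.map_map (by fun_prop) (by fun_prop)]
    rfl
  apply Measure.ext_of_charFun
  rw [hind.charFun_map_fun_sum_eq_prod fun j => (hm j).aemeasurable]
  ext t
  simp only [hlaw, Finset.prod_apply, charFun_gaussianReal, ← Complex.exp_sum]
  congr 1
  have hy' : ∑ j, (y j : ℂ) ^ 2 = 1 := by exact_mod_cast hy
  simp only [NNReal.coe_mul, NNReal.coe_mk, Complex.ofReal_mul, Complex.ofReal_zero, mul_zero,
    zero_mul, zero_sub, Complex.ofReal_pow]
  rw [Finset.sum_neg_distrib, ← Finset.sum_div, ← Finset.sum_mul, ← Finset.sum_mul, hy', one_mul]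

lemma map_mulVec_pi_gaussianReal {ι κ : Type*} [Fintype ι] [Fintype κ] (v : ℝ≥0) {y : κ → ℝ}
    (hy : ∑ j, y j ^ 2 = 1) :
    (Measure.pi fun _ : ι × κ => gaussianReal 0 v).map (fun ω i => ∑ j, ω (i, j) * y j) =
      Measure.pi fun _ : ι => gaussianReal 0 v := by
  have h := Measure.infinitePi_map_curry fun (_ : ι) (_ : κ) => gaussianReal 0 v
  simp only [Measure.infinitePi_eq_pi] at h
  have hcomp : (fun (ω : ι × κ → ℝ) i => ∑ j, ω (i, j) * y j) =
      (fun (z : ι → κ → ℝ) i => ∑ j, z i j * y j) ∘ MeasurableEquiv.curry ι κ ℝ := rfl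
  have hpi := Measure.pi_map_pi (μ := fun _ : ι => Measure.pi fun _ : κ => gaussianReal 0 v)
    (f := fun _ (z : κ → ℝ) => ∑ j, z j * y j) (hμ := ?_)
    fun _ => (by fun_prop : Measurable fun z : κ → ℝ => ∑ j, z j * y j).aemeasurable
  · rw [hcomp, ← Measure.map_map (by fun_prop) (by fun_prop), h, hpi]
    simp only [map_sum_mul_pi_gaussianReal v hy]
  · intro i
    rw [map_sum_mul_pi_gaussianReal v hy]
    infer_instance

lemma neg_half_log_one_sub_le {t : ℝ} (ht : |t| ≤ 1 / 4) :
    -t - Real.log (1 - 2 * t) / 2 ≤ 4 * t ^ 2 := by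
  have h2 : |2 * t| ≤ 1 / 2 := by rw [abs_mul, abs_two]; linarith
  have h := Real.abs_log_sub_add_sum_range_le (x := 2 * t) (by linarith) 1
  have hb : |2 * t| ^ (1 + 1) / (1 - |2 * t|) ≤ 8 * t ^ 2 := by
    rw [div_le_iff₀ (by linarith), one_add_one_eq_two, sq_abs]
    nlinarith [sq_nonneg t]
  have h' := (abs_le.1 (h.trans hb)).1
  simp at h'
  linarith

lemma exp_mul_sq_gaussianReal {v : ℝ≥0} (hv : v ≠ 0) {t : ℝ} (ht : |t| ≤ 1 / 4) :
    Integrable (fun x : ℝ => Real.exp (t * (x ^ 2 / v - 1))) (gaussianReal 0 v) ∧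
      ∫ x, Real.exp (t * (x ^ 2 / v - 1)) ∂gaussianReal 0 v ≤ Real.exp (4 * t ^ 2) := by
  have hv0 : (0 : ℝ) < v := by positivity
  have ht1 : 0 < 1 - 2 * t := by linarith [(abs_le.1 ht).2]
  set b : ℝ := (1 - 2 * t) / (2 * v) with hb
  have hb0 : 0 < b := by positivity
  have key : ∀ x : ℝ, gaussianPDFReal 0 v x • Real.exp (t * (x ^ 2 / v - 1)) =
      (√(2 * Real.pi * v))⁻¹ * Real.exp (-t) * Real.exp (-b * x ^ 2) := by
    intro x
    rw [gaussianPDFReal, smul_eq_mul, mul_assoc, mul_assoc _ (Real.exp (-t)), ← Real.exp_add,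
      ← Real.exp_add]
    congr 2
    rw [hb]
    field_simp
    ring
  constructor
  · rw [gaussianReal_of_var_ne_zero _ hv, gaussianPDF_def,
      integrable_withDensity_iff_integrable_smul' (by fun_prop) (by simp)]
    simp_rw [ENNReal.toReal_ofReal (gaussianPDFReal_nonneg _ _ _), key]
    exact (integrable_exp_neg_mul_sq hb0).const_mul _
  · rw [integral_gaussianReal_eq_integral_smul hv]
    simp_rw [key]
    rw [integral_const_mul, integral_gaussian, mul_right_comm, ← Real.sqrt_inv,
      ← Real.sqrt_mul (by positivity)]
    have : (2 * Real.pi * (v : ℝ))⁻¹ * (Real.pi / b) = (1 - 2 * t)⁻¹ := by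
      rw [hb]; field_simp
    rw [this, Real.sqrt_eq_rpow, Real.rpow_def_of_pos (by positivity), ← Real.exp_add,
      Real.log_inv]
    apply Real.exp_le_exp.2
    linarith [neg_half_log_one_sub_le ht]

lemma measureReal_pi_gaussianReal_sum_sq_le {ι : Type*} [Fintype ι] {v : ℝ≥0} (hv : v ≠ 0)
    {t : ℝ} (ht : |t| ≤ 1 / 4) (a : ℝ) :
    (Measure.pi fun _ : ι => gaussianReal 0 v).real
        {z | a ≤ t * ∑ i, (z i ^ 2 / v - 1)} ≤
      Real.exp (-a + 4 * t ^ 2 * Fintype.card ι) := by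
  set μ := Measure.pi fun _ : ι => gaussianReal 0 v
  let X : ι → (ι → ℝ) → ℝ := fun i z => t * (z i ^ 2 / v - 1)
  have hX : ∀ i, Measurable (X i) := by fun_prop
  have hind : iIndepFun X μ :=
    iIndepFun_pi (X := fun _ (x : ℝ) => t * (x ^ 2 / v - 1)) (by fun_prop)
  have hmp : ∀ i, MeasurePreserving (Function.eval i) μ (gaussianReal 0 v) :=
    measurePreserving_eval fun _ : ι => gaussianReal 0 v
  have hint : ∀ i, Integrable (fun z => Real.exp (1 * X i z)) μ := by
    intro i
    simpa [X, Function.comp_def] using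
      (hmp i).integrable_comp_of_integrable (exp_mul_sq_gaussianReal hv ht).1
  have hmgf : ∀ i, mgf (X i) μ 1 ≤ Real.exp (4 * t ^ 2) := by
    intro i
    refine le_of_eq_of_le ?_ (exp_mul_sq_gaussianReal hv ht).2
    rw [← (hmp i).map_eq, integral_map (hmp i).aemeasurable (by fun_prop)]
    simp [mgf, X]
  have h := measure_ge_le_exp_mul_mgf (μ := μ) (X := ∑ i, X i) (t := 1) a zero_le_one
    (hind.integrable_exp_mul_sum hX fun i _ => hint i)
  rw [hind.mgf_sum hX] at h
  have hset : {z : ι → ℝ | a ≤ t * ∑ i, (z i ^ 2 / v - 1)} = {z | a ≤ (∑ i, X i) z} := by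
    simp only [X, Finset.mul_sum, Finset.sum_apply]
  rw [hset, Real.exp_add]
  refine h.trans ?_
  rw [neg_one_mul]
  gcongr
  calc ∏ i, mgf (X i) μ 1 ≤ ∏ _i : ι, Real.exp (4 * t ^ 2) :=
        Finset.prod_le_prod (fun i _ => mgf_nonneg) fun i _ => hmgf i
    _ = Real.exp (4 * t ^ 2 * Fintype.card ι) := by
        rw [Finset.prod_const, Finset.card_univ, ← Real.exp_nat_mul, mul_comm]

lemma measureReal_pi_gaussianReal_abs_sum_sq_sub_one_le {k : ℕ} (hk : 0 < k) {η : ℝ}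
    (hη : 0 ≤ η) (hη' : η ≤ 2) :
    (Measure.pi fun _ : Fin k => gaussianReal 0 (k : ℝ≥0)⁻¹).real
        {z | η ≤ |∑ i, z i ^ 2 - 1|} ≤ 2 * Real.exp (-(k * η ^ 2 / 16)) := by
  have hk0 : (0 : ℝ) < k := by positivity
  have hv : (k : ℝ≥0)⁻¹ ≠ 0 := by positivity
  have hsum : ∀ z : Fin k → ℝ,
      ∑ i, (z i ^ 2 / ((k : ℝ≥0)⁻¹ : ℝ≥0) - 1) = k * (∑ i, z i ^ 2 - 1) := by
    intro z
    simp [mul_sub, Finset.mul_sum, mul_comm]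
  have h₁ := measureReal_pi_gaussianReal_sum_sq_le (ι := Fin k) hv (t := η / 8)
    (by rw [abs_of_nonneg] <;> linarith) (k * η ^ 2 / 8)
  have h₂ := measureReal_pi_gaussianReal_sum_sq_le (ι := Fin k) hv (t := -(η / 8))
    (by rw [abs_neg, abs_of_nonneg] <;> linarith) (k * η ^ 2 / 8)
  have he : -(k * η ^ 2 / 8) + 4 * (η / 8) ^ 2 * k = -(k * η ^ 2 / 16) := by ring
  simp only [hsum, Fintype.card_fin, neg_sq, he] at h₁ h₂
  refine (measureReal_mono (fun z hz => ?_)).trans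
    ((measureReal_union_le _ _).trans ((add_le_add h₁ h₂).trans_eq (two_mul _).symm))
  have hz' : η ≤ |∑ i, z i ^ 2 - 1| := hz
  rcases le_abs.1 hz' with h | h
  · left
    have := mul_le_mul_of_nonneg_left h (by positivity : 0 ≤ k * η / 8)
    simp only [Set.mem_ofPred_eq]
    linarith
  · right
    have := mul_le_mul_of_nonneg_left h (by positivity : 0 ≤ k * η / 8)
    simp only [Set.mem_ofPred_eq]
    linarith

lemma norm_smul_sub_smul_sq_real {E : Type*} [NormedAddCommGroup E] [InnerProductSpace ℝ E]
    (u w : E) (a b : ℝ) :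
    ‖a • u - b • w‖ ^ 2 = a ^ 2 * ‖u‖ ^ 2 - 2 * a * b * inner ℝ u w + b ^ 2 * ‖w‖ ^ 2 := by
  rw [norm_sub_sq_real, norm_smul, norm_smul, real_inner_smul_left, real_inner_smul_right,
    mul_pow, mul_pow, Real.norm_eq_abs, Real.norm_eq_abs, sq_abs, sq_abs]
  ring

lemma abs_sq_norm_sub_le_of_net {E F : Type*} [NormedAddCommGroup E] [InnerProductSpace ℝ E]
    [FiniteDimensional ℝ E] [NormedAddCommGroup F] [InnerProductSpace ℝ F] (L : E →ₗ[ℝ] F)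
    (N : Set E) (hN : ∀ x : E, ‖x‖ = 1 → ∃ y ∈ N, ‖y‖ = 1 ∧ ‖x - y‖ ≤ 1 / 2) {η : ℝ}
    (hL : ∀ y ∈ N, |‖L y‖ ^ 2 - 1| ≤ η) (x : E) :
    |‖L x‖ ^ 2 - ‖x‖ ^ 2| ≤ 32 * η * ‖x‖ ^ 2 := by
  by_cases hx : x = 0
  · simp [hx]
  have : Nontrivial E := ⟨x, 0, hx⟩
  let Q : E → ℝ := fun x => ‖L x‖ ^ 2 - ‖x‖ ^ 2
  have hQs : ∀ (c : ℝ) z, Q (c • z) = c ^ 2 * Q z := by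
    intro c z
    simp only [Q, map_smul, norm_smul, mul_pow, Real.norm_eq_abs, sq_abs]
    ring
  have hQc : Continuous Q := by
    have : Continuous L := L.continuous_of_finiteDimensional
    fun_prop
  obtain ⟨m, hm, hmax⟩ := (isCompact_sphere (0 : E) 1).exists_isMaxOn
    (NormedSpace.sphere_nonempty.2 zero_le_one) hQc.abs.continuousOn
  have hm1 : ‖m‖ = 1 := by simpa using hm
  have hle : ∀ z, |Q z| ≤ |Q m| * ‖z‖ ^ 2 := by
    intro z
    by_cases hz : z = 0
    · simp [hz, Q]
    have hz' : 0 < ‖z‖ := norm_pos_iff.2 hz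
    have h1 : |Q (‖z‖⁻¹ • z)| ≤ |Q m| := hmax (by simp [norm_smul, hz'.ne'])
    rw [hQs, abs_mul, abs_of_nonneg (sq_nonneg _), inv_pow, inv_mul_le_iff₀ (by positivity)] at h1
    linarith
  obtain ⟨y, hyN, hy1, hmy⟩ := hN m hm1
  have hLy : |Q y| ≤ η := by simpa [Q, hy1] using hL y hyN
  have hin : 7 / 8 ≤ inner ℝ m y := by
    have := norm_sub_sq_real m y
    rw [hm1, hy1] at this
    nlinarith [norm_nonneg (m - y)]
  have hid : 16 * (Q m - Q y) =
      Q ((5 : ℝ) • m - (3 : ℝ) • y) - Q ((3 : ℝ) • m - (5 : ℝ) • y) := by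
    simp only [Q, map_sub, map_smul, norm_smul_sub_smul_sq_real]
    ring
  have hn1 : ‖(5 : ℝ) • m - (3 : ℝ) • y‖ ^ 2 ≤ 31 / 4 := by
    rw [norm_smul_sub_smul_sq_real, hm1, hy1]; linarith
  have hn2 : ‖(3 : ℝ) • m - (5 : ℝ) • y‖ ^ 2 ≤ 31 / 4 := by
    rw [norm_smul_sub_smul_sq_real, hm1, hy1]; linarith
  have hq1 := (hle _).trans (mul_le_mul_of_nonneg_left hn1 (abs_nonneg (Q m)))
  have hq2 := (hle _).trans (mul_le_mul_of_nonneg_left hn2 (abs_nonneg (Q m)))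
  have hQm : |Q m| ≤ 32 * η := by
    have h1 := abs_sub (Q ((5 : ℝ) • m - (3 : ℝ) • y)) (Q ((3 : ℝ) • m - (5 : ℝ) • y))
    rw [← hid, abs_mul, abs_of_pos (by norm_num : (0 : ℝ) < 16)] at h1
    have h2 := abs_sub_abs_le_abs_sub (Q m) (Q y)
    linarith
  exact (hle x).trans (by gcongr)

lemma exists_finset_net_sphere (E : Type*) [NormedAddCommGroup E] [NormedSpace ℝ E]
    [FiniteDimensional ℝ E] :
    ∃ N : Finset E, N.card ≤ 5 ^ Module.finrank ℝ E ∧ (∀ y ∈ N, ‖y‖ = 1) ∧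
      ∀ x : E, ‖x‖ = 1 → ∃ y ∈ N, ‖x - y‖ ≤ 1 / 2 := by
  classical
  let P : ℕ → Prop := fun c => ∃ s : Finset E, s.card = c ∧ (∀ y ∈ s, ‖y‖ = 1) ∧
    ∀ x ∈ s, ∀ y ∈ s, x ≠ y → 1 / 2 ≤ ‖x - y‖
  have hP : ∀ c, P c → c ≤ 5 ^ Module.finrank ℝ E := by
    rintro c ⟨s, rfl, hs, hsep⟩
    have hinj : Function.Injective fun x : E => (2 : ℝ) • x :=
      smul_right_injective E two_ne_zero
    rw [← Finset.card_image_of_injective s hinj]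
    apply Besicovitch.card_le_of_separated
    · simp only [Finset.forall_mem_image, norm_smul]
      intro x hx
      simp [hs x hx]
    · simp only [Finset.forall_mem_image, ← smul_sub, norm_smul]
      intro x hx y hy hxy
      have := hsep x hx y hy (fun h => hxy (by rw [h]))
      rw [Real.norm_two]
      linarith
  have hP0 : P 0 := ⟨∅, by simp⟩
  obtain ⟨s, hcard, hs, hsep⟩ := Nat.findGreatest_spec (P := P) (Nat.zero_le _) hP0
    (n := 5 ^ Module.finrank ℝ E)
  refine ⟨s, hP _ ⟨s, rfl, hs, hsep⟩, hs, fun x hx => ?_⟩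
  by_contra! hfar
  have hxs : x ∉ s := fun h => by simpa using (hfar x h).trans' (by norm_num : (0 : ℝ) < 1 / 2)
  have hins : P (s.card + 1) := by
    refine ⟨insert x s, Finset.card_insert_of_notMem hxs, ?_, ?_⟩
    · simpa [hx] using hs
    · intro a ha b hb hab
      rcases Finset.mem_insert.1 ha with rfl | ha <;> rcases Finset.mem_insert.1 hb with rfl | hb
      · exact absurd rfl hab
      · exact (hfar b hb).le
      · rw [norm_sub_rev]; exact (hfar a (by assumption)).le
      · exact hsep a ha b hb hab
  have := Nat.le_findGreatest (hP _ hins) hins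
  omega

lemma euclNorm_eq_norm {n : ℕ} (x : Fin n → ℝ) : euclNorm x = ‖WithLp.toLp 2 x‖ := by
  simp [euclNorm, EuclideanSpace.norm_eq]

lemma two_mul_pow_mul_exp_le {ε δ : ℝ} (hε : 0 < ε) (hδ : 0 < δ) (hδ' : δ < 1) {k d : ℕ}
    (hd : d ≠ 0)
    (hk : (k : ℝ) ≥ 49152 * ((d : ℝ) + Real.log (1 / δ)) / ε ^ 2) :
    (5 : ℝ) ^ d * (2 * Real.exp (-(k * (ε / 32) ^ 2 / 16))) ≤ δ := by
  have hlog : 0 < Real.log (1 / δ) := Real.log_pos (one_lt_one_div hδ hδ')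
  have h1 : 49152 * ((d : ℝ) + Real.log (1 / δ)) ≤ k * ε ^ 2 := (div_le_iff₀ (by positivity)).1 hk
  have h2 : Real.exp (-(k * (ε / 32) ^ 2 / 16)) ≤ (Real.exp (d * 3))⁻¹ * δ := by
    nth_rewrite 1 [← Real.exp_log hδ]
    rw [← Real.exp_neg, ← Real.exp_add, Real.exp_le_exp]
    rw [one_div, Real.log_inv] at hlog h1
    linarith
  have h3 : (5 : ℝ) ^ d * 2 ≤ Real.exp (d * 3) := by
    have he : (10 : ℝ) ≤ Real.exp 3 := by
      rw [show (3 : ℝ) = (3 : ℕ) * 1 by norm_num, Real.exp_nat_mul]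
      calc (10 : ℝ) ≤ 2.7 ^ 3 := by norm_num
        _ ≤ _ := by gcongr; linarith [Real.exp_one_gt_d9]
    calc (5 : ℝ) ^ d * 2 ≤ 5 ^ d * 2 ^ d := by gcongr; exact le_self_pow₀ one_le_two hd
      _ = 10 ^ d := by rw [← mul_pow]; norm_num
      _ ≤ Real.exp 3 ^ d := by gcongr
      _ = Real.exp (d * 3) := (Real.exp_nat_mul _ _).symm
  calc (5 : ℝ) ^ d * (2 * Real.exp (-(k * (ε / 32) ^ 2 / 16)))
      ≤ 5 ^ d * (2 * ((Real.exp (d * 3))⁻¹ * δ)) := by gcongr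
    _ = (5 ^ d * 2) / Real.exp (d * 3) * δ := by rw [div_eq_mul_inv]; ring
    _ ≤ 1 * δ := by gcongr; exact div_le_one_of_le₀ h3 (Real.exp_pos _).le
    _ = δ := one_mul δ

lemma mul_le_and_le_mul_of_abs_sq_sub_sq_le {a b ε : ℝ} (ha : 0 ≤ a) (hb : 0 ≤ b) (hε : 0 ≤ ε)
    (hε' : ε ≤ 1) (h : |a ^ 2 - b ^ 2| ≤ ε * b ^ 2) : (1 - ε) * b ≤ a ∧ a ≤ (1 + ε) * b := by
  obtain ⟨h1, h2⟩ := abs_le.1 h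
  have hεb : 0 ≤ ε * b ^ 2 := by positivity
  have hεεb : ε * (ε * b ^ 2) ≤ 1 * (ε * b ^ 2) := by gcongr
  constructor
  · apply le_of_sq_le_sq _ ha
    linarith [mul_nonneg hε hεb]
  · apply le_of_sq_le_sq _ (by positivity)
    linarith [mul_nonneg hε hεb]

/-- a `k × n` matrix of i.i.d. Gaussian entries of mean `0` and variance
`1/k`, with `k ≥ C(d + log(1/δ))/ε²`, is with probability at least `1 − δ` a
`(1 ± ε)` ℓ₂-subspace embedding for any fixed `n × d` matrix `A`. -/
theorem stmt3 :
    ∃ C : ℝ, 0 < C ∧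
      ∀ (ε δ : ℝ), 0 < ε → ε < 1 → 0 < δ → δ < 1 →
      ∀ (k n d : ℕ), (k : ℝ) ≥ C * ((d : ℝ) + Real.log (1 / δ)) / ε ^ 2 →
      ∀ A : Matrix (Fin n) (Fin d) ℝ,
        (Measure.pi fun _ : Fin k × Fin n => gaussianReal 0 (k : ℝ≥0)⁻¹)
          {ω | ∀ x : Fin d → ℝ,
            (1 - ε) * euclNorm (A.mulVec x)
                ≤ euclNorm (((Matrix.of fun i j => ω (i, j)) * A).mulVec x) ∧
            euclNorm (((Matrix.of fun i j => ω (i, j)) * A).mulVec x)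
                ≤ (1 + ε) * euclNorm (A.mulVec x)}
          ≥ ENNReal.ofReal (1 - δ) := by
  refine ⟨49152, by norm_num, fun ε δ hε hε' hδ hδ' k n d hk A => ?_⟩
  have hk0 : 0 < k := by
    have hlog : 0 < Real.log (1 / δ) := Real.log_pos (one_lt_one_div hδ hδ')
    have h0 : (0 : ℝ) < k := lt_of_lt_of_le (by positivity) hk
    exact_mod_cast h0
  set μ := Measure.pi fun _ : Fin k × Fin n => gaussianReal 0 (k : ℝ≥0)⁻¹
  let E := LinearMap.range (Matrix.toEuclideanLin A)
  have hE : Module.finrank ℝ E ≤ d := by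
    simpa using LinearMap.finrank_range_le (Matrix.toEuclideanLin A)
  obtain ⟨N, hNcard, hN1, hN⟩ := exists_finset_net_sphere E
  let B : E → Set (Fin k × Fin n → ℝ) := fun y =>
    {ω | ε / 32 ≤ |∑ i, (∑ j, ω (i, j) * (y : EuclideanSpace ℝ (Fin n)) j) ^ 2 - 1|}
  have hBm : ∀ y, MeasurableSet (B y) := fun y =>
    measurableSet_le measurable_const (by fun_prop)
  have hB : ∀ y ∈ N, μ.real (B y) ≤ 2 * Real.exp (-(k * (ε / 32) ^ 2 / 16)) := by
    intro y hy
    have hy1 : ∑ j, (y : EuclideanSpace ℝ (Fin n)) j ^ 2 = 1 := by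
      rw [← EuclideanSpace.real_norm_sq_eq, Submodule.norm_coe, hN1 y hy, one_pow]
    have hmap := map_mulVec_pi_gaussianReal (ι := Fin k) (k : ℝ≥0)⁻¹ hy1
    have h := measureReal_pi_gaussianReal_abs_sum_sq_sub_one_le hk0 (η := ε / 32)
      (by positivity) (by linarith)
    rwa [← hmap, map_measureReal_apply (by fun_prop)
      (measurableSet_le measurable_const (by fun_prop))] at h
  have hunion : μ.real (⋃ y ∈ N, B y) ≤ δ := by
    by_cases hd : d = 0
    · have : Subsingleton E := Module.finrank_zero_iff (R := ℝ).1 (by omega)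
      have hN0 : N = ∅ := Finset.eq_empty_of_forall_notMem fun y hy => by
        have := hN1 y hy
        simp [Subsingleton.elim y 0] at this
      simpa [hN0] using hδ.le
    · calc μ.real (⋃ y ∈ N, B y) ≤ ∑ y ∈ N, μ.real (B y) := measureReal_biUnion_finset_le _ _
        _ ≤ N.card * (2 * Real.exp (-(k * (ε / 32) ^ 2 / 16))) := by
            simpa using Finset.sum_le_card_nsmul N _ _ hB
        _ ≤ (5 : ℝ) ^ d * (2 * Real.exp (-(k * (ε / 32) ^ 2 / 16))) := by
            gcongr
            exact_mod_cast hNcard.trans (Nat.pow_le_pow_right (by norm_num) hE)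
        _ ≤ δ := two_mul_pow_mul_exp_le hε hδ hδ' hd hk
  have hcompl : ENNReal.ofReal (1 - δ) ≤ μ (⋃ y ∈ N, B y)ᶜ := by
    rw [← ofReal_measureReal, probReal_compl_eq_one_sub (N.measurableSet_biUnion fun y _ => hBm y)]
    exact ENNReal.ofReal_le_ofReal (by linarith)
  refine hcompl.trans (measure_mono fun ω hω x => ?_)
  let S : Matrix (Fin k) (Fin n) ℝ := Matrix.of fun i j => ω (i, j)
  let L : E →ₗ[ℝ] EuclideanSpace ℝ (Fin k) := (Matrix.toEuclideanLin S).comp E.subtype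
  have hL : ∀ y ∈ N, |‖L y‖ ^ 2 - 1| ≤ ε / 32 := by
    intro y hy
    have hωy : ω ∉ B y := fun h => hω (Set.mem_biUnion hy h)
    rw [EuclideanSpace.real_norm_sq_eq]
    exact (not_le.1 hωy).le
  have hx := abs_sq_norm_sub_le_of_net L N
    (fun x hx => (hN x hx).imp fun y hy => ⟨hy.1, hN1 y hy.1, hy.2⟩) hL
    ⟨Matrix.toEuclideanLin A (WithLp.toLp 2 x), LinearMap.mem_range_self _ _⟩
  rw [mul_div_cancel₀ ε (by norm_num : (32 : ℝ) ≠ 0)] at hx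
  rw [euclNorm_eq_norm, euclNorm_eq_norm, ← Matrix.mulVec_mulVec]
  exact mul_le_and_le_mul_of_abs_sq_sub_sq_le (norm_nonneg _) (norm_nonneg _) hε.le hε'.le hx
end

section
/- (Leverage score sampling gives a subspace embedding.) Let Z be a real n×k matrix with orthonormal columns (ZᵀZ = I_k), and for i ∈ {1,…,n} let pᵢ = ‖eᵢᵀZ‖₂²/k (the normalized leverage scores, which form a probability distribution). Let β ∈ (0, 1] and let q = (q₁, …, q_n) be a probability distribution on {1,…,n} with qᵢ ≥ β·pᵢ for all i. Let 0 < ε < 1, 0 < δ < 1, and let s be an integer with s > 144·k·ln(2k/δ)/(β·ε²). Sample indices i₁, …, i_s independently, each with distribution q, and let Y be the s×k random matrix whose j-th row equals (1/√(s·q_{i_j}))·(the i_j-th row of Z) whenever q_{i_j} > 0 (rows with q_{i_j} = 0 occur with probability zero and may be set to 0). Then with probability at least 1 − δ, simultaneously for all x ∈ ℝ^k, (1 − ε)‖x‖₂² ≤ ‖Yx‖₂² ≤ (1 + ε)‖x‖₂² (equivalently, all squared singular values of Y lie in [1 − ε, 1 + ε]). -/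
open MeasureTheory Matrix

theorem Matrix.IsHermitian.exists_quadForm_pow_eq_sum {ι : Type*} [Fintype ι] [DecidableEq ι]
    {C : Matrix ι ι ℝ} (hC : C.IsHermitian) :
    ∃ (ev : ι → ℝ) (U : Matrix ι ι ℝ),
      (∀ (v : ι → ℝ) (a : ℕ), v ⬝ᵥ (C ^ a *ᵥ v) = ∑ l, (U *ᵥ v) l ^ 2 * ev l ^ a) ∧
      (∀ a : ℕ, (C ^ a).trace = ∑ l, ev l ^ a) ∧
      ∀ l, ∃ x : ι → ℝ, x ⬝ᵥ x = 1 ∧ x ⬝ᵥ (C *ᵥ x) = ev l := by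
  have hspec := hC.spectral_theorem
  set V : Matrix ι ι ℝ := (hC.eigenvectorUnitary : Matrix ι ι ℝ) with hV
  have h1 : Vᵀ * V = 1 := by
    have := Unitary.coe_star_mul_self hC.eigenvectorUnitary
    simpa [star_eq_conjTranspose] using this
  have h0 : C = V * diagonal hC.eigenvalues * Vᵀ := by
    conv_lhs => rw [hspec]
    simp [Unitary.conjStarAlgAut_apply, star_eq_conjTranspose, hV]
  clear_value V
  generalize hC.eigenvalues = ev at h0
  have h2 : ∀ a : ℕ, C ^ a = V * diagonal (fun l => ev l ^ a) * Vᵀ := by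
    intro a
    induction a with
    | zero => simp [mul_eq_one_comm.mp h1]
    | succ a ih =>
      rw [pow_succ, ih, h0]
      calc _ = V * diagonal (fun l => ev l ^ a) * (Vᵀ * V) * diagonal ev * Vᵀ := by simp only [Matrix.mul_assoc]
        _ = _ := by
          rw [h1, Matrix.mul_one, Matrix.mul_assoc V, diagonal_mul_diagonal]
          simp only [pow_succ]
  have hquad : ∀ (v : ι → ℝ) (a : ℕ),
      v ⬝ᵥ (C ^ a *ᵥ v) = ∑ l, (Vᵀ *ᵥ v) l ^ 2 * ev l ^ a := by
    intro v a
    rw [h2, ← mulVec_mulVec, ← mulVec_mulVec, dotProduct_mulVec, ← mulVec_transpose]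
    simp only [dotProduct, mulVec_diagonal]
    exact Finset.sum_congr rfl fun l _ => by ring
  refine ⟨ev, Vᵀ, hquad, fun a => ?_, fun l => ⟨V *ᵥ Pi.single l 1, ?_, ?_⟩⟩
  · rw [h2, trace_mul_comm, ← Matrix.mul_assoc, h1, Matrix.one_mul, trace_diagonal]
  · have h := hquad (V *ᵥ Pi.single l 1) 0
    rw [mulVec_mulVec _ Vᵀ, h1] at h
    simpa [Matrix.one_apply] using h
  · have h := hquad (V *ᵥ Pi.single l 1) 1
    rw [mulVec_mulVec _ Vᵀ, h1] at h
    simpa [Matrix.one_apply] using h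

theorem dotProduct_mul_vecMulVec_mul_mulVec {ι : Type*} [Fintype ι]
    (A B : Matrix ι ι ℝ) (v x : ι → ℝ) :
    x ⬝ᵥ ((A * vecMulVec v v * B) *ᵥ x) = (x ⬝ᵥ (A *ᵥ v)) * (v ⬝ᵥ (B *ᵥ x)) := by
  rw [← mulVec_mulVec, ← mulVec_mulVec, vecMulVec_mulVec]
  simp [mulVec_smul, mul_comm]

theorem trace_mul_vecMulVec_self {ι : Type*} [Fintype ι] (A : Matrix ι ι ℝ) (v : ι → ℝ) :
    (A * vecMulVec v v).trace = v ⬝ᵥ (A *ᵥ v) := by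
  rw [mul_vecMulVec, trace_vecMulVec, dotProduct_comm]

section
variable {ι : Type*} [Fintype ι] [DecidableEq ι]

/-- `C` is symmetric with all eigenvalues at least `c`. -/
def HermitianGE (c : ℝ) (C : Matrix ι ι ℝ) : Prop :=
  C.IsHermitian ∧ ∀ x : ι → ℝ, c * (x ⬝ᵥ x) ≤ x ⬝ᵥ (C *ᵥ x)

theorem HermitianGE.exists_quadForm_pow_eq_sum {c : ℝ} {C : Matrix ι ι ℝ} (hC : HermitianGE c C) :
    ∃ (ev : ι → ℝ) (U : Matrix ι ι ℝ), (∀ l, c ≤ ev l) ∧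
      (∀ (v : ι → ℝ) (a : ℕ), v ⬝ᵥ (C ^ a *ᵥ v) = ∑ l, (U *ᵥ v) l ^ 2 * ev l ^ a) ∧
      ∀ a : ℕ, (C ^ a).trace = ∑ l, ev l ^ a := by
  obtain ⟨ev, U, hq, ht, hl⟩ := hC.1.exists_quadForm_pow_eq_sum
  refine ⟨ev, U, fun l => ?_, hq, ht⟩
  obtain ⟨x, hx, hx'⟩ := hl l
  simpa [hx, hx'] using hC.2 x

theorem HermitianGE.quadForm_pow_nonneg {c : ℝ} (hc : 0 ≤ c) {C : Matrix ι ι ℝ}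
    (hC : HermitianGE c C) (v : ι → ℝ) (a : ℕ) : 0 ≤ v ⬝ᵥ (C ^ a *ᵥ v) := by
  obtain ⟨ev, U, hev, hq, -⟩ := hC.exists_quadForm_pow_eq_sum
  rw [hq]
  exact Finset.sum_nonneg fun l _ =>
    mul_nonneg (sq_nonneg _) (pow_nonneg (hc.trans (hev l)) _)

theorem HermitianGE.mul_quadForm_pow_le {c : ℝ} (hc : 0 ≤ c) {C : Matrix ι ι ℝ}
    (hC : HermitianGE c C) (v : ι → ℝ) (a : ℕ) :
    c * (v ⬝ᵥ (C ^ a *ᵥ v)) ≤ v ⬝ᵥ (C ^ (a + 1) *ᵥ v) := by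
  obtain ⟨ev, U, hev, hq, -⟩ := hC.exists_quadForm_pow_eq_sum
  rw [hq, hq, Finset.mul_sum]
  refine Finset.sum_le_sum fun l _ => ?_
  have h := mul_le_mul_of_nonneg_right (hev l)
    (mul_nonneg (sq_nonneg ((U *ᵥ v) l)) (pow_nonneg (hc.trans (hev l)) a))
  calc _ ≤ _ := (by linarith : _ ≤ ev l * ((U *ᵥ v) l ^ 2 * ev l ^ a))
    _ = _ := by ring

theorem HermitianGE.quadForm_pow_mul_le {c : ℝ} (hc : 0 ≤ c) {C : Matrix ι ι ℝ}
    (hC : HermitianGE c C) (v : ι → ℝ) (a b : ℕ) :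
    (v ⬝ᵥ (C ^ a *ᵥ v)) * (v ⬝ᵥ (C ^ b *ᵥ v)) ≤ (v ⬝ᵥ v) * (v ⬝ᵥ (C ^ (a + b) *ᵥ v)) := by
  obtain ⟨ev, U, hev, hq, -⟩ := hC.exists_quadForm_pow_eq_sum
  have h0 := hq v 0
  simp only [pow_zero, one_mulVec, mul_one] at h0
  rw [hq, hq, hq, h0]
  have hmono : ∀ (a : ℕ) l m, ev l ≤ ev m → ev l ^ a ≤ ev m ^ a := fun a l m h =>
    pow_le_pow_left₀ (hc.trans (hev l)) h a
  have key : ∀ l m, 0 ≤ (ev l ^ a - ev m ^ a) * (ev l ^ b - ev m ^ b) := by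
    intro l m
    rcases le_total (ev l) (ev m) with h | h
    · exact mul_nonneg_of_nonpos_of_nonpos (sub_nonpos.2 (hmono a _ _ h))
        (sub_nonpos.2 (hmono b _ _ h))
    · exact mul_nonneg (sub_nonneg.2 (hmono a _ _ h)) (sub_nonneg.2 (hmono b _ _ h))
  set w := fun l => (U *ᵥ v) l ^ 2 with hw
  have hsum : 0 ≤ ∑ l, ∑ m, w l * w m * ((ev l ^ a - ev m ^ a) * (ev l ^ b - ev m ^ b)) :=
    Finset.sum_nonneg fun l _ => Finset.sum_nonneg fun m _ =>
      mul_nonneg (mul_nonneg (sq_nonneg _) (sq_nonneg _)) (key l m)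
  have e : ∑ l, ∑ m, w l * w m * ((ev l ^ a - ev m ^ a) * (ev l ^ b - ev m ^ b))
      = (∑ l, w l * ev l ^ (a + b)) * (∑ l, w l) + (∑ l, w l) * (∑ l, w l * ev l ^ (a + b))
        - (∑ l, w l * ev l ^ a) * (∑ l, w l * ev l ^ b)
        - (∑ l, w l * ev l ^ b) * (∑ l, w l * ev l ^ a) := by
    simp only [Finset.sum_mul_sum, ← Finset.sum_add_distrib, ← Finset.sum_sub_distrib]
    exact Finset.sum_congr rfl fun l _ => Finset.sum_congr rfl fun m _ => by ring
  change (∑ l, w l * ev l ^ a) * (∑ l, w l * ev l ^ b) ≤ (∑ l, w l) * (∑ l, w l * ev l ^ (a + b))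
  nlinarith

theorem HermitianGE.trace_pow_nonneg {c : ℝ} (hc : 0 ≤ c) {C : Matrix ι ι ℝ}
    (hC : HermitianGE c C) (a : ℕ) : 0 ≤ (C ^ a).trace := by
  obtain ⟨ev, U, hev, -, ht⟩ := hC.exists_quadForm_pow_eq_sum
  rw [ht]
  exact Finset.sum_nonneg fun l _ => pow_nonneg (hc.trans (hev l)) _

theorem HermitianGE.trace_pow_le_trace_pow_succ {C : Matrix ι ι ℝ}
    (hC : HermitianGE 1 C) (a : ℕ) : (C ^ a).trace ≤ (C ^ (a + 1)).trace := by
  obtain ⟨ev, U, hev, -, ht⟩ := hC.exists_quadForm_pow_eq_sum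
  rw [ht, ht]
  exact Finset.sum_le_sum fun l _ => pow_le_pow_right₀ (hev l) a.le_succ

theorem HermitianGE.trace_pow_succ_le_trace_pow {c : ℝ} (hc : 0 ≤ c) {C : Matrix ι ι ℝ}
    (hC : HermitianGE c C) (hC1 : ∀ x : ι → ℝ, x ⬝ᵥ (C *ᵥ x) ≤ x ⬝ᵥ x) (a : ℕ) :
    (C ^ (a + 1)).trace ≤ (C ^ a).trace := by
  obtain ⟨ev, U, -, ht, hl⟩ := hC.1.exists_quadForm_pow_eq_sum
  rw [ht, ht]
  refine Finset.sum_le_sum fun l _ => ?_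
  obtain ⟨x, hx, hx'⟩ := hl l
  have h0 := hC.2 x
  have h1 := hC1 x
  rw [hx, hx'] at h0 h1
  exact pow_le_pow_of_le_one (by linarith) h1 a.le_succ

theorem HermitianGE.pow_le_trace_pow {c : ℝ} (hc : 0 ≤ c) {C : Matrix ι ι ℝ}
    (hC : HermitianGE c C) {t : ℝ} (ht0 : 0 ≤ t) {x : ι → ℝ}
    (hx : t * (x ⬝ᵥ x) < x ⬝ᵥ (C *ᵥ x)) (a : ℕ) : t ^ a ≤ (C ^ a).trace := by
  obtain ⟨ev, U, hev, hq, ht⟩ := hC.exists_quadForm_pow_eq_sum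
  have h0 := hq x 0
  have h1 := hq x 1
  simp only [pow_zero, one_mulVec, mul_one, pow_one] at h0 h1
  rw [h0, h1, Finset.mul_sum] at hx
  obtain ⟨l, -, hl⟩ := Finset.exists_lt_of_sum_lt hx
  have hl' : t ≤ ev l := by
    by_contra! hlt
    nlinarith [sq_nonneg ((U *ᵥ x) l)]
  rw [ht]
  exact (pow_le_pow_left₀ ht0 hl' a).trans (Finset.single_le_sum (f := fun l => ev l ^ a)
    (fun m _ => pow_nonneg (hc.trans (hev m)) _) (Finset.mem_univ l))

section RankOne
variable {c τ : ℝ} {C : Matrix ι ι ℝ} {v : ι → ℝ}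

theorem quadForm_pow_succ_mul (a i : ℕ) :
    v ⬝ᵥ (((C + τ • vecMulVec v v) ^ (i + 1) * C ^ a) *ᵥ v)
      = v ⬝ᵥ (((C + τ • vecMulVec v v) ^ i * C ^ (a + 1)) *ᵥ v)
        + τ * ((v ⬝ᵥ ((C + τ • vecMulVec v v) ^ i *ᵥ v)) * (v ⬝ᵥ (C ^ a *ᵥ v))) := by
  rw [← dotProduct_mul_vecMulVec_mul_mulVec, ← smul_eq_mul τ, ← dotProduct_smul, ← smul_mulVec,
    ← dotProduct_add, ← add_mulVec, pow_succ (C + τ • vecMulVec v v), pow_succ' C]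
  congr 2
  generalize (C + τ • vecMulVec v v) ^ i = D
  rw [Matrix.mul_add, Matrix.add_mul]
  simp [Matrix.mul_assoc]

theorem quadForm_mul_pow_nonneg (hc : 0 ≤ c) (hτ : 0 ≤ τ) (hC : HermitianGE c C) (i : ℕ) :
    ∀ a, 0 ≤ v ⬝ᵥ (((C + τ • vecMulVec v v) ^ i * C ^ a) *ᵥ v) := by
  induction i with
  | zero => intro a; simpa using hC.quadForm_pow_nonneg hc v a
  | succ i ih =>
    intro a
    rw [quadForm_pow_succ_mul]
    have h0 := ih 0
    rw [pow_zero, Matrix.mul_one] at h0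
    exact add_nonneg (ih _) (mul_nonneg hτ (mul_nonneg h0 (hC.quadForm_pow_nonneg hc v a)))

theorem quadForm_mul_pow_step (hc : 0 ≤ c) (hτ : 0 ≤ τ) (hC : HermitianGE c C) (a i : ℕ) :
    v ⬝ᵥ (((C + τ • vecMulVec v v) ^ i * C ^ (a + 1)) *ᵥ v)
      ≤ v ⬝ᵥ (((C + τ • vecMulVec v v) ^ (i + 1) * C ^ a) *ᵥ v) := by
  rw [quadForm_pow_succ_mul]
  have h0 := quadForm_mul_pow_nonneg (v := v) hc hτ hC i 0
  rw [pow_zero, Matrix.mul_one] at h0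
  exact le_add_of_nonneg_right (mul_nonneg hτ (mul_nonneg h0 (hC.quadForm_pow_nonneg hc v a)))

theorem le_quadForm_mul_pow (hc : 0 ≤ c) (hτ : 0 ≤ τ) (hC : HermitianGE c C) (i : ℕ) :
    ∀ a, v ⬝ᵥ (C ^ (a + i) *ᵥ v) ≤ v ⬝ᵥ (((C + τ • vecMulVec v v) ^ i * C ^ a) *ᵥ v) := by
  induction i with
  | zero => intro a; simp
  | succ i ih =>
    intro a
    have := ih (a + 1)
    rw [show a + 1 + i = a + (i + 1) by ring] at this
    exact this.trans (quadForm_mul_pow_step hc hτ hC a i)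

theorem quadForm_mul_pow_le (hc : 0 ≤ c) (hτ : 0 ≤ τ) (hC : HermitianGE c C) (a : ℕ) :
    ∀ i, v ⬝ᵥ (((C + τ • vecMulVec v v) ^ i * C ^ a) *ᵥ v)
      ≤ v ⬝ᵥ ((C + τ • vecMulVec v v) ^ (a + i) *ᵥ v) := by
  induction a with
  | zero => intro i; simp
  | succ a ih =>
    intro i
    have := ih (i + 1)
    rw [show a + (i + 1) = a + 1 + i by ring] at this
    exact (quadForm_mul_pow_step hc hτ hC a i).trans this

theorem quadForm_mul_pow_le_pow_mul {L : ℝ} (hc : 0 < c) (hτ : 0 ≤ τ) (hC : HermitianGE c C)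
    (hL : v ⬝ᵥ v ≤ L) (i : ℕ) :
    ∀ a, v ⬝ᵥ (((C + τ • vecMulVec v v) ^ i * C ^ a) *ᵥ v)
      ≤ (1 + τ * L / c) ^ i * (v ⬝ᵥ (C ^ (a + i) *ᵥ v)) := by
  have hvv : 0 ≤ v ⬝ᵥ v := by simpa using hC.quadForm_pow_nonneg hc.le v 0
  have hL0 : 0 ≤ L := hvv.trans hL
  have hR : 0 ≤ 1 + τ * L / c := by positivity
  induction i with
  | zero => intro a; simp
  | succ i ih =>
    intro a
    rw [quadForm_pow_succ_mul]
    have h0 := ih 0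
    rw [pow_zero, Matrix.mul_one, zero_add] at h0
    have h1 := ih (a + 1)
    have ha := hC.quadForm_pow_nonneg hc.le v a
    have h2 := hC.quadForm_pow_mul_le hc.le v i a
    have h3 := hC.mul_quadForm_pow_le hc.le v (i + a)
    have h4 := hC.quadForm_pow_nonneg hc.le v (i + a)
    rw [show a + 1 + i = i + a + 1 by ring] at h1
    rw [show a + (i + 1) = i + a + 1 by ring]
    set R := (1 + τ * L / c) ^ i with hRdef
    have hRi : 0 ≤ R := by positivity
    set y := v ⬝ᵥ (C ^ (i + a + 1) *ᵥ v)
    have h5 : v ⬝ᵥ (C ^ (i + a) *ᵥ v) ≤ y / c := by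
      rw [le_div_iff₀ hc]; linarith
    calc _ ≤ R * y + τ * (R * (v ⬝ᵥ (C ^ i *ᵥ v)) * (v ⬝ᵥ (C ^ a *ᵥ v))) := by gcongr
      _ = R * y + τ * R * ((v ⬝ᵥ (C ^ i *ᵥ v)) * (v ⬝ᵥ (C ^ a *ᵥ v))) := by ring
      _ ≤ R * y + τ * R * (L * (y / c)) := by
        gcongr R * y + τ * R * ?_
        exact h2.trans (mul_le_mul hL h5 h4 hL0)
      _ = _ := by rw [pow_succ, ← hRdef]; ring

theorem trace_pow_mul_pow_succ (a i : ℕ) :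
    (C ^ a * (C + τ • vecMulVec v v) ^ (i + 1)).trace
      = (C ^ (a + 1) * (C + τ • vecMulVec v v) ^ i).trace
        + τ * (v ⬝ᵥ (((C + τ • vecMulVec v v) ^ i * C ^ a) *ᵥ v)) := by
  rw [← trace_mul_vecMulVec_self, ← smul_eq_mul τ, ← trace_smul, pow_succ' (C + τ • vecMulVec v v),
    pow_succ C]
  generalize (C + τ • vecMulVec v v) ^ i = D
  rw [Matrix.mul_assoc D, trace_smul, trace_mul_comm D, ← trace_smul, ← trace_add]
  congr 1
  rw [Matrix.add_mul, Matrix.mul_add]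
  simp [Matrix.mul_assoc]

theorem trace_pow_add_le (hc : 0 ≤ c) (hτ : 0 ≤ τ) (hC : HermitianGE c C) (N : ℕ) :
    (C ^ (N + 1)).trace + (N + 1) * τ * (v ⬝ᵥ (C ^ N *ᵥ v))
      ≤ ((C + τ • vecMulVec v v) ^ (N + 1)).trace := by
  have key : ∀ i a, a + i = N + 1 → (C ^ (N + 1)).trace + i * τ * (v ⬝ᵥ (C ^ N *ᵥ v))
      ≤ (C ^ a * (C + τ • vecMulVec v v) ^ i).trace := by
    intro i
    induction i with
    | zero => intro a h; obtain rfl : a = N + 1 := h; simp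
    | succ i ih =>
      intro a h
      rw [trace_pow_mul_pow_succ]
      have h1 := ih (a + 1) (by omega)
      have h2 := mul_le_mul_of_nonneg_left (le_quadForm_mul_pow (v := v) hc hτ hC i a) hτ
      rw [show a + i = N by omega] at h2
      push_cast
      linarith
  simpa using key (N + 1) 0 (by simp)

theorem trace_pow_le_add (hc : 0 ≤ c) (hτ : 0 ≤ τ) (hC : HermitianGE c C) (N : ℕ) :
    ((C + τ • vecMulVec v v) ^ (N + 1)).trace ≤ (C ^ (N + 1)).trace
      + (N + 1) * τ * (v ⬝ᵥ ((C + τ • vecMulVec v v) ^ N *ᵥ v)) := by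
  have key : ∀ i a, a + i = N + 1 → (C ^ a * (C + τ • vecMulVec v v) ^ i).trace
      ≤ (C ^ (N + 1)).trace + i * τ * (v ⬝ᵥ ((C + τ • vecMulVec v v) ^ N *ᵥ v)) := by
    intro i
    induction i with
    | zero => intro a h; obtain rfl : a = N + 1 := h; simp
    | succ i ih =>
      intro a h
      rw [trace_pow_mul_pow_succ]
      have h1 := ih (a + 1) (by omega)
      have h2 := mul_le_mul_of_nonneg_left (quadForm_mul_pow_le (v := v) hc hτ hC a i) hτ
      rw [show a + i = N by omega] at h2
      push_cast
      linarith
  simpa using key (N + 1) 0 (by simp)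

end RankOne

theorem vecMulVec_quadForm {ι : Type*} [Fintype ι] (v x : ι → ℝ) :
    x ⬝ᵥ (vecMulVec v v *ᵥ x) = (v ⬝ᵥ x) ^ 2 := by
  rw [vecMulVec_mulVec]
  simp [dotProduct_comm x v, sq]

theorem dotProduct_sq_le {ι : Type*} [Fintype ι] (v x : ι → ℝ) :
    (v ⬝ᵥ x) ^ 2 ≤ (v ⬝ᵥ v) * (x ⬝ᵥ x) := by
  simpa only [dotProduct, ← sq] using Finset.sum_mul_sq_le_sq_mul_sq Finset.univ v x

theorem isHermitian_smul_vecMulVec_self {ι : Type*} (τ : ℝ) (v : ι → ℝ) :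
    (τ • vecMulVec v v).IsHermitian := by
  ext i j
  simp [vecMulVec_apply, mul_comm]

theorem sum_prod_mul_le_pow {κ α : Type*} [Fintype κ] [AddCommMonoid α] {q : κ → ℝ}
    (hq : ∀ i, 0 ≤ q i) (X : κ → α) (F : α → ℝ) (P : ℕ → α → Prop) {ρ : ℝ} (hρ : 0 ≤ ρ)
    (hP : ∀ s a i, P (s + 1) a → P s (a + X i))
    (hF : ∀ s a, P (s + 1) a → ∑ i, q i * F (a + X i) ≤ ρ * F a) (s : ℕ) :
    ∀ a, P s a →
      ∑ ω : Fin s → κ, (∏ j, q (ω j)) * F (a + ∑ j, X (ω j)) ≤ ρ ^ s * F a := by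
  induction s with
  | zero => intro a _; simp
  | succ s ih =>
    intro a ha
    rw [← (Fin.consEquiv fun _ : Fin (s + 1) => κ).sum_comp, Fintype.sum_prod_type]
    simp only [Fin.consEquiv_apply, Fin.prod_univ_succ, Fin.sum_univ_succ, Fin.cons_zero,
      Fin.cons_succ, ← add_assoc, mul_assoc, ← Finset.mul_sum]
    calc _ ≤ ∑ i, q i * (ρ ^ s * F (a + X i)) :=
          Finset.sum_le_sum fun i _ => mul_le_mul_of_nonneg_left (ih _ (hP s a i ha)) (hq i)
      _ = ρ ^ s * ∑ i, q i * F (a + X i) := by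
          rw [Finset.mul_sum]
          exact Finset.sum_congr rfl fun i _ => by ring
      _ ≤ ρ ^ s * (ρ * F a) := mul_le_mul_of_nonneg_left (hF s a ha) (pow_nonneg hρ s)
      _ = _ := by ring

theorem measureReal_pi_le_div_of_sum_le {κ : Type*} [Fintype κ] [MeasurableSpace κ]
    [MeasurableSingletonClass κ] {s : ℕ} (ν : Measure κ) [IsProbabilityMeasure ν] {q : κ → ℝ}
    (hq : ∀ i, 0 ≤ q i) (hν : ∀ i, ν {i} = ENNReal.ofReal (q i)) (F : (Fin s → κ) → ℝ)
    (hF : ∀ ω, 0 ≤ F ω) {K t : ℝ} (hsum : ∑ ω : Fin s → κ, (∏ j, q (ω j)) * F ω ≤ K)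
    (ht : 0 < t) {S : Set (Fin s → κ)} (hS : ∀ ω ∈ S, t ≤ F ω) :
    (Measure.pi fun _ : Fin s => ν).real S ≤ K / t := by
  classical
  have hw : ∀ ω : Fin s → κ, (Measure.pi fun _ : Fin s => ν).real {ω} = ∏ j, q (ω j) := by
    intro ω
    rw [measureReal_def, Measure.pi_singleton, ENNReal.toReal_prod]
    exact Finset.prod_congr rfl fun j _ => by rw [hν, ENNReal.toReal_ofReal (hq _)]
  have hS' : (Measure.pi fun _ : Fin s => ν).real S = ∑ ω ∈ S.toFinset, ∏ j, q (ω j) := by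
    rw [← Finset.sum_congr rfl fun ω _ => hw ω, sum_measureReal_singleton, Set.coe_toFinset]
  rw [hS', le_div_iff₀ ht, Finset.sum_mul]
  calc _ ≤ ∑ ω ∈ S.toFinset, (∏ j, q (ω j)) * F ω :=
        Finset.sum_le_sum fun ω hω => mul_le_mul_of_nonneg_left (hS ω (Set.mem_toFinset.1 hω))
          (Finset.prod_nonneg fun j _ => hq _)
    _ ≤ ∑ ω, (∏ j, q (ω j)) * F ω :=
        Finset.sum_le_sum_of_subset_of_nonneg (Finset.subset_univ _) fun ω _ _ =>
          mul_nonneg (Finset.prod_nonneg fun j _ => hq _) (hF ω)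
    _ ≤ K := hsum

theorem HermitianGE.add_smul_vecMulVec {ι : Type*} [Fintype ι] {c τ : ℝ} {C : Matrix ι ι ℝ} (hC : HermitianGE c C)
    (hτ : 0 ≤ τ) (v : ι → ℝ) : HermitianGE c (C + τ • vecMulVec v v) := by
  refine ⟨hC.1.add (isHermitian_smul_vecMulVec_self τ v), fun x => ?_⟩
  rw [add_mulVec, dotProduct_add, smul_mulVec, dotProduct_smul, vecMulVec_quadForm, smul_eq_mul]
  have := hC.2 x
  have := mul_nonneg hτ (sq_nonneg (v ⬝ᵥ x))
  linarith

theorem HermitianGE.sub_smul_vecMulVec {ι : Type*} [Fintype ι] {c τ L : ℝ} {C : Matrix ι ι ℝ}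
    (hC : HermitianGE (c + τ * L) C) (hτ : 0 ≤ τ) {v : ι → ℝ} (hv : v ⬝ᵥ v ≤ L) :
    HermitianGE c (C - τ • vecMulVec v v) := by
  refine ⟨hC.1.sub (isHermitian_smul_vecMulVec_self τ v), fun x => ?_⟩
  rw [sub_mulVec, dotProduct_sub, smul_mulVec, dotProduct_smul, vecMulVec_quadForm, smul_eq_mul]
  have h1 := hC.2 x
  have hx : 0 ≤ x ⬝ᵥ x := by simpa using dotProduct_star_self_nonneg x
  have h2 := mul_le_mul_of_nonneg_left
    ((dotProduct_sq_le v x).trans (mul_le_mul_of_nonneg_right hv hx)) hτ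
  linarith

section Sampling
variable {κ : Type*} [Fintype κ] {q : κ → ℝ} {r : κ → ι → ℝ} {L σ τ : ℝ}

theorem sum_mul_quadForm_eq (hiso : ∑ i, q i • vecMulVec (r i) (r i) = σ • (1 : Matrix ι ι ℝ))
    (A : Matrix ι ι ℝ) : ∑ i, q i * (r i ⬝ᵥ (A *ᵥ r i)) = σ * A.trace := by
  have h := congrArg (fun M => (A * M).trace) hiso
  simpa [Matrix.mul_sum, trace_sum, trace_mul_vecMulVec_self] using h

theorem sum_prod_mul_trace_add_pow_le (hq : ∀ i, 0 ≤ q i) (hq1 : ∑ i, q i = 1)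
    (hiso : ∑ i, q i • vecMulVec (r i) (r i) = σ • (1 : Matrix ι ι ℝ))
    (hr : ∀ i, r i ⬝ᵥ r i ≤ L) (hL : 0 ≤ L) (hσ : 0 ≤ σ) (hτ : 0 ≤ τ) (N s : ℕ) :
    ∑ ω : Fin s → κ, (∏ j, q (ω j)) *
        ((1 + ∑ j, τ • vecMulVec (r (ω j)) (r (ω j))) ^ (N + 1)).trace
      ≤ Real.exp ((N + 1) * τ * (1 + τ * L) ^ N * σ) ^ s * Fintype.card ι := by
  have h := sum_prod_mul_le_pow hq (fun i => τ • vecMulVec (r i) (r i))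
    (fun C : Matrix ι ι ℝ => (C ^ (N + 1)).trace) (fun _ C => HermitianGE 1 C)
    (Real.exp_pos ((N + 1) * τ * (1 + τ * L) ^ N * σ)).le
    (fun _ C i hC => hC.add_smul_vecMulVec hτ (r i)) (fun _ C hC => ?_) s 1
    ⟨isHermitian_one, by simp⟩
  · simpa using h
  set R := (1 + τ * L) ^ N with hR
  have hstep : ∀ i, ((C + τ • vecMulVec (r i) (r i)) ^ (N + 1)).trace
      ≤ (C ^ (N + 1)).trace + (N + 1) * τ * (R * (r i ⬝ᵥ (C ^ N *ᵥ r i))) := by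
    intro i
    refine (trace_pow_le_add zero_le_one hτ hC N).trans ?_
    have := quadForm_mul_pow_le_pow_mul one_pos hτ hC (hr i) N 0
    rw [pow_zero, Matrix.mul_one, zero_add, div_one] at this
    gcongr
  have h0 := hC.trace_pow_nonneg zero_le_one (N + 1)
  have hR0 : 0 ≤ R := by positivity
  calc ∑ i, q i * ((C + τ • vecMulVec (r i) (r i)) ^ (N + 1)).trace
      ≤ ∑ i, q i * ((C ^ (N + 1)).trace + (N + 1) * τ * (R * (r i ⬝ᵥ (C ^ N *ᵥ r i)))) :=
        Finset.sum_le_sum fun i _ => mul_le_mul_of_nonneg_left (hstep i) (hq i)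
    _ = (∑ i, q i) * (C ^ (N + 1)).trace
        + (N + 1) * τ * R * ∑ i, q i * (r i ⬝ᵥ (C ^ N *ᵥ r i)) := by
        rw [Finset.sum_mul, Finset.mul_sum, ← Finset.sum_add_distrib]
        exact Finset.sum_congr rfl fun i _ => by ring
    _ = (C ^ (N + 1)).trace + (N + 1) * τ * R * σ * (C ^ N).trace := by
        rw [hq1, sum_mul_quadForm_eq hiso]; ring
    _ ≤ (C ^ (N + 1)).trace + (N + 1) * τ * R * σ * (C ^ (N + 1)).trace := by
        gcongr
        exact hC.trace_pow_le_trace_pow_succ N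
    _ = ((N + 1) * τ * R * σ + 1) * (C ^ (N + 1)).trace := by ring
    _ ≤ _ := mul_le_mul_of_nonneg_right (Real.add_one_le_exp _) h0

theorem sum_prod_mul_trace_sub_pow_le (hq : ∀ i, 0 ≤ q i) (hq1 : ∑ i, q i = 1)
    (hiso : ∑ i, q i • vecMulVec (r i) (r i) = σ • (1 : Matrix ι ι ℝ))
    (hr : ∀ i, r i ⬝ᵥ r i ≤ L) (hL : 0 ≤ L) (hσ : 0 ≤ σ) (hτ : 0 ≤ τ) (N s : ℕ)
    (hs : 1 / 2 + s * (τ * L) ≤ 1) :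
    ∑ ω : Fin s → κ, (∏ j, q (ω j)) *
        ((1 + ∑ j, -(τ • vecMulVec (r (ω j)) (r (ω j)))) ^ (N + 1)).trace
      ≤ Real.exp (-((N + 1) * τ / (1 + 2 * (τ * L)) ^ N * σ)) ^ s * Fintype.card ι := by
  have hP : ∀ (s : ℕ) (C : Matrix ι ι ℝ), HermitianGE (1 / 2 + (s + 1 : ℕ) * (τ * L)) C →
      ∀ i, HermitianGE (1 / 2 + s * (τ * L)) (C - τ • vecMulVec (r i) (r i)) := by
    intro s C hC i
    refine HermitianGE.sub_smul_vecMulVec (L := L) ?_ hτ (hr i)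
    convert hC using 1
    push_cast; ring
  have h := sum_prod_mul_le_pow hq (fun i => -(τ • vecMulVec (r i) (r i)))
    (fun C : Matrix ι ι ℝ => (C ^ (N + 1)).trace)
    (fun s C => HermitianGE (1 / 2 + s * (τ * L)) C ∧ ∀ x : ι → ℝ, x ⬝ᵥ (C *ᵥ x) ≤ x ⬝ᵥ x)
    (Real.exp_pos (-((N + 1) * τ / (1 + 2 * (τ * L)) ^ N * σ))).le
    (fun s C i hC => ?_) (fun s C hC => ?_) s 1
    ⟨⟨isHermitian_one, fun x => ?_⟩, by simp⟩
  · simpa using h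
  · rw [← sub_eq_add_neg]
    refine ⟨hP s C hC.1 i, fun x => ?_⟩
    rw [sub_mulVec, dotProduct_sub, smul_mulVec, dotProduct_smul, vecMulVec_quadForm, smul_eq_mul]
    have := hC.2 x
    have := mul_nonneg hτ (sq_nonneg (r i ⬝ᵥ x))
    linarith
  · set R := (1 + 2 * (τ * L)) ^ N with hR
    have hR0 : 0 < R := by positivity
    have hc : (1 / 2 : ℝ) ≤ 1 / 2 + s * (τ * L) := by
      have : 0 ≤ s * (τ * L) := by positivity
      linarith
    have hstep : ∀ i, ((C + -(τ • vecMulVec (r i) (r i))) ^ (N + 1)).trace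
        ≤ (C ^ (N + 1)).trace - (N + 1) * τ / R * (r i ⬝ᵥ (C ^ N *ᵥ r i)) := by
      intro i
      have hD : HermitianGE (1 / 2) (C - τ • vecMulVec (r i) (r i)) := by
        have h1 := hP s C hC.1 i
        refine ⟨h1.1, fun x => le_trans ?_ (h1.2 x)⟩
        exact mul_le_mul_of_nonneg_right hc (by simpa using dotProduct_star_self_nonneg x)
      rw [← sub_eq_add_neg]
      have h1 := trace_pow_add_le (v := r i) (by norm_num) hτ hD N
      have h2 := quadForm_mul_pow_le_pow_mul (by norm_num) hτ hD (hr i) N 0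
      rw [pow_zero, Matrix.mul_one, zero_add, sub_add_cancel,
        show 1 + τ * L / (1 / 2) = 1 + 2 * (τ * L) by ring, ← hR, ← div_le_iff₀' hR0] at h2
      rw [sub_add_cancel] at h1
      have h3 : (N + 1) * τ * ((r i ⬝ᵥ (C ^ N *ᵥ r i)) / R)
          ≤ (N + 1) * τ * (r i ⬝ᵥ ((C - τ • vecMulVec (r i) (r i)) ^ N *ᵥ r i)) := by gcongr
      have h4 : (N + 1) * τ * ((r i ⬝ᵥ (C ^ N *ᵥ r i)) / R)
        = (N + 1) * τ / R * (r i ⬝ᵥ (C ^ N *ᵥ r i)) := by ring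
      linarith
    have hc0 : (0 : ℝ) ≤ 1 / 2 + (s + 1 : ℕ) * (τ * L) := by positivity
    have h0 := hC.1.trace_pow_nonneg hc0 (N + 1)
    calc ∑ i, q i * ((C + -(τ • vecMulVec (r i) (r i))) ^ (N + 1)).trace
        ≤ ∑ i, q i * ((C ^ (N + 1)).trace - (N + 1) * τ / R * (r i ⬝ᵥ (C ^ N *ᵥ r i))) :=
          Finset.sum_le_sum fun i _ => mul_le_mul_of_nonneg_left (hstep i) (hq i)
      _ = (∑ i, q i) * (C ^ (N + 1)).trace
          - (N + 1) * τ / R * ∑ i, q i * (r i ⬝ᵥ (C ^ N *ᵥ r i)) := by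
          rw [Finset.sum_mul, Finset.mul_sum, ← Finset.sum_sub_distrib]
          exact Finset.sum_congr rfl fun i _ => by ring
      _ = (C ^ (N + 1)).trace - (N + 1) * τ / R * σ * (C ^ N).trace := by
          rw [hq1, sum_mul_quadForm_eq hiso]; ring
      _ ≤ (C ^ (N + 1)).trace - (N + 1) * τ / R * σ * (C ^ (N + 1)).trace := by
          gcongr
          exact hC.1.trace_pow_succ_le_trace_pow hc0 hC.2 N
      _ = (-((N + 1) * τ / R * σ) + 1) * (C ^ (N + 1)).trace := by ring
      _ ≤ _ := mul_le_mul_of_nonneg_right (Real.add_one_le_exp _) h0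
  · rw [one_mulVec]
    exact mul_le_of_le_one_left (by simpa using dotProduct_star_self_nonneg x) hs

end Sampling

theorem mul_exp_le_of_eventually_mul_one_add_div_pow_le {p a K : ℝ}
    (h : ∀ᶠ N : ℕ in Filter.atTop, p * (1 + a / (N + 1)) ^ (N + 1) ≤ K) :
    p * Real.exp a ≤ K := by
  have h1 := ((Real.tendsto_one_add_div_pow_exp a).comp
    (Filter.tendsto_add_atTop_nat 1)).const_mul p
  refine le_of_tendsto h1 (h.mono fun N hN => ?_)
  simpa using hN

theorem one_add_div_pow_le_exp {a : ℝ} (ha : 0 ≤ a) (N : ℕ) :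
    (1 + a / (N + 1)) ^ N ≤ Real.exp a := by
  have h1 : 1 + a / (N + 1) ≤ Real.exp (a / (N + 1)) := by
    rw [add_comm]; exact Real.add_one_le_exp _
  calc _ ≤ (1 + a / (N + 1)) ^ (N + 1) :=
        pow_le_pow_right₀ (le_add_of_nonneg_right (by positivity)) N.le_succ
    _ ≤ Real.exp (a / (N + 1)) ^ (N + 1) := pow_le_pow_left₀ (by positivity) h1 _
    _ = Real.exp a := by
        rw [← Real.exp_nat_mul]; congr 1; push_cast; field_simp

section Tail
variable {κ : Type*} [Fintype κ] [MeasurableSpace κ] [MeasurableSingletonClass κ]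
  {q : κ → ℝ} {r : κ → ι → ℝ} {L ε : ℝ} {s : ℕ}

theorem measureReal_pi_lt_quadForm_le (ν : Measure κ) [IsProbabilityMeasure ν]
    (hq : ∀ i, 0 ≤ q i) (hq1 : ∑ i, q i = 1) (hν : ∀ i, ν {i} = ENNReal.ofReal (q i))
    (hs : 0 < s) (hL : 0 < L) (hr : ∀ i, r i ⬝ᵥ r i ≤ L)
    (hiso : ∑ i, q i • vecMulVec (r i) (r i) = (1 / s : ℝ) • (1 : Matrix ι ι ℝ))
    (hε : 0 < ε) (hε1 : ε < 1) :
    (Measure.pi fun _ : Fin s => ν).real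
        {ω | ∃ x : ι → ℝ, (1 + ε) * (x ⬝ᵥ x) < ∑ j, (r (ω j) ⬝ᵥ x) ^ 2}
      ≤ Fintype.card ι * Real.exp (-(ε ^ 2 / (8 * L))) := by
  set S := {ω : Fin s → κ | ∃ x : ι → ℝ, (1 + ε) * (x ⬝ᵥ x) < ∑ j, (r (ω j) ⬝ᵥ x) ^ 2}
  set θ := ε / (4 * L) with hθ
  have hs' : (s : ℝ) ≠ 0 := by positivity
  have hθ0 : 0 < θ := by positivity
  have hθL : θ * L = ε / 4 := by rw [hθ]; field_simp
  have key : ∀ N : ℕ, (Measure.pi fun _ : Fin s => ν).real S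
      * (1 + θ * (1 + ε) / (N + 1)) ^ (N + 1)
      ≤ Real.exp (θ * Real.exp (θ * L)) * Fintype.card ι := by
    intro N
    set τ := θ / (N + 1) with hτ
    have hτ0 : 0 < τ := by positivity
    have h1 := sum_prod_mul_trace_add_pow_le hq hq1 hiso hr hL.le (by positivity) hτ0.le N s
    have hge : ∀ ω : Fin s → κ,
        HermitianGE 1 (1 + ∑ j, τ • vecMulVec (r (ω j)) (r (ω j)) : Matrix ι ι ℝ) := by
      intro ω
      have : ∀ t : Finset (Fin s),
          HermitianGE 1 (1 + ∑ j ∈ t, τ • vecMulVec (r (ω j)) (r (ω j)) : Matrix ι ι ℝ) := by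
        intro t
        induction t using Finset.induction_on with
        | empty => exact ⟨by simp, by simp⟩
        | insert a t ha ih =>
          rw [Finset.sum_insert ha, add_comm (τ • _), ← add_assoc]
          exact ih.add_smul_vecMulVec hτ0.le _
      exact this _
    have h2 := measureReal_pi_le_div_of_sum_le ν hq hν _
      (fun ω => (hge ω).trace_pow_nonneg zero_le_one (N + 1)) h1
      (t := (1 + τ * (1 + ε)) ^ (N + 1)) (by positivity) (S := S) ?_
    · rw [le_div_iff₀ (by positivity)] at h2
      rw [show θ * (1 + ε) / (N + 1) = τ * (1 + ε) by rw [hτ]; ring]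
      refine h2.trans (mul_le_mul_of_nonneg_right ?_ (by positivity))
      rw [← Real.exp_nat_mul, Real.exp_le_exp]
      have h3 := one_add_div_pow_le_exp (a := θ * L) (by positivity) N
      rw [show θ * L / (N + 1) = τ * L by rw [hτ]; ring] at h3
      calc _ = θ * (1 + τ * L) ^ N := by rw [hτ]; field_simp
        _ ≤ _ := by gcongr
    · rintro ω ⟨x, hx⟩
      refine (hge ω).pow_le_trace_pow zero_le_one (by positivity) (x := x) ?_ _
      have := mul_lt_mul_of_pos_left hx hτ0
      rw [add_mulVec, dotProduct_add, sum_mulVec, dotProduct_sum, one_mulVec]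
      simp only [smul_mulVec, dotProduct_smul, vecMulVec_quadForm, smul_eq_mul]
      rw [← Finset.mul_sum]
      linarith
  have h := mul_exp_le_of_eventually_mul_one_add_div_pow_le (Filter.Eventually.of_forall key)
  rw [← le_div_iff₀ (Real.exp_pos _)] at h
  refine h.trans ?_
  rw [mul_comm, mul_div_assoc, ← Real.exp_sub]
  gcongr
  have h4 : Real.exp (θ * L) ≤ 1 + 2 * (θ * L) := by
    have := Real.abs_exp_sub_one_le (x := θ * L) (by rw [hθL, abs_of_pos] <;> linarith)
    rw [abs_of_pos (by positivity : 0 < θ * L)] at this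
    linarith [le_abs_self (Real.exp (θ * L) - 1)]
  calc _ ≤ θ * (1 + 2 * (θ * L)) - θ * (1 + ε) := by gcongr
    _ = _ := by rw [hθL, hθ]; field_simp; ring

theorem measureReal_pi_quadForm_lt_le (ν : Measure κ) [IsProbabilityMeasure ν]
    (hq : ∀ i, 0 ≤ q i) (hq1 : ∑ i, q i = 1) (hν : ∀ i, ν {i} = ENNReal.ofReal (q i))
    (hs : 0 < s) (hL : 0 < L) (hr : ∀ i, r i ⬝ᵥ r i ≤ L)
    (hiso : ∑ i, q i • vecMulVec (r i) (r i) = (1 / s : ℝ) • (1 : Matrix ι ι ℝ))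
    (hε : 0 < ε) (hε1 : ε < 1) :
    (Measure.pi fun _ : Fin s => ν).real
        {ω | ∃ x : ι → ℝ, ∑ j, (r (ω j) ⬝ᵥ x) ^ 2 < (1 - ε) * (x ⬝ᵥ x)}
      ≤ Fintype.card ι * Real.exp (-(ε ^ 2 / (8 * L))) := by
  set S := {ω : Fin s → κ | ∃ x : ι → ℝ, ∑ j, (r (ω j) ⬝ᵥ x) ^ 2 < (1 - ε) * (x ⬝ᵥ x)}
  set θ := ε / (4 * L) with hθ
  have hs' : (s : ℝ) ≠ 0 := by positivity
  have hθ0 : 0 < θ := by positivity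
  have hθL : θ * L = ε / 4 := by rw [hθ]; field_simp
  have key : ∀ N : ℕ, 2 * s * (θ * L) ≤ N → 2 * θ ≤ N → (Measure.pi fun _ : Fin s => ν).real S
      * (1 + -(θ * (1 - ε)) / (N + 1)) ^ (N + 1)
      ≤ Real.exp (-(θ * Real.exp (-(2 * (θ * L))))) * Fintype.card ι := by
    intro N hN hN'
    set τ := θ / (N + 1) with hτ
    have hτ0 : 0 < τ := by positivity
    have hτs : 1 / 2 + s * (τ * L) ≤ 1 := by
      have : s * (τ * L) ≤ 1 / 2 := by
        rw [show s * (τ * L) = s * (θ * L) / (N + 1) by rw [hτ]; ring, div_le_iff₀ (by positivity)]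
        linarith
      linarith
    have hτ1 : τ ≤ 1 / 2 := by
      rw [hτ, div_le_iff₀ (by positivity)]
      linarith
    have ht0 : 0 < 1 - τ * (1 - ε) := by nlinarith
    have h1 := sum_prod_mul_trace_sub_pow_le hq hq1 hiso hr hL.le (by positivity) hτ0.le N s hτs
    have hge : ∀ ω : Fin s → κ,
        HermitianGE 0 (1 + ∑ j, -(τ • vecMulVec (r (ω j)) (r (ω j))) : Matrix ι ι ℝ) := by
      intro ω
      have : ∀ t : Finset (Fin s), HermitianGE (1 - t.card * (τ * L))
          (1 + ∑ j ∈ t, -(τ • vecMulVec (r (ω j)) (r (ω j))) : Matrix ι ι ℝ) := by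
        intro t
        induction t using Finset.induction_on with
        | empty => exact ⟨by simp, by simp⟩
        | insert a t ha ih =>
          rw [Finset.sum_insert ha, add_comm (-(τ • _)), ← add_assoc, ← sub_eq_add_neg]
          refine HermitianGE.sub_smul_vecMulVec (L := L) ?_ hτ0.le (hr _)
          convert ih using 1
          rw [Finset.card_insert_of_notMem ha]
          push_cast; ring
      have h := this Finset.univ
      rw [Finset.card_univ, Fintype.card_fin] at h
      refine ⟨h.1, fun x => le_trans ?_ (h.2 x)⟩
      exact mul_le_mul_of_nonneg_right (by linarith)
        (by simpa using dotProduct_star_self_nonneg x)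
    have h2 := measureReal_pi_le_div_of_sum_le ν hq hν _
      (fun ω => (hge ω).trace_pow_nonneg le_rfl (N + 1)) h1
      (t := (1 - τ * (1 - ε)) ^ (N + 1)) (by positivity) (S := S) ?_
    · rw [le_div_iff₀ (by positivity)] at h2
      rw [show 1 + -(θ * (1 - ε)) / (N + 1) = 1 - τ * (1 - ε) by rw [hτ]; ring]
      refine h2.trans (mul_le_mul_of_nonneg_right ?_ (by positivity))
      rw [← Real.exp_nat_mul, Real.exp_le_exp]
      have h3 := one_add_div_pow_le_exp (a := 2 * (θ * L)) (by positivity) N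
      rw [show 2 * (θ * L) / (N + 1) = 2 * (τ * L) by rw [hτ]; ring] at h3
      have h4 : θ * Real.exp (-(2 * (θ * L))) ≤ θ * ((1 + 2 * (τ * L)) ^ N)⁻¹ := by
        rw [Real.exp_neg]
        gcongr
      calc _ = -(θ * ((1 + 2 * (τ * L)) ^ N)⁻¹) := by rw [hτ]; field_simp
        _ ≤ _ := neg_le_neg h4
    · rintro ω ⟨x, hx⟩
      refine (hge ω).pow_le_trace_pow le_rfl ht0.le (x := x) ?_ _
      have := mul_lt_mul_of_pos_left hx hτ0
      rw [add_mulVec, dotProduct_add, sum_mulVec, dotProduct_sum, one_mulVec]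
      simp only [neg_mulVec, dotProduct_neg, smul_mulVec, dotProduct_smul, vecMulVec_quadForm,
        smul_eq_mul, Finset.sum_neg_distrib]
      rw [← Finset.mul_sum]
      linarith
  have h := mul_exp_le_of_eventually_mul_one_add_div_pow_le
    ((tendsto_natCast_atTop_atTop.eventually_ge_atTop (2 * s * (θ * L))).mp
      ((tendsto_natCast_atTop_atTop.eventually_ge_atTop (2 * θ)).mono fun N h1 h2 => key N h2 h1))
  rw [← le_div_iff₀ (Real.exp_pos _)] at h
  refine h.trans ?_
  rw [mul_comm, mul_div_assoc, ← Real.exp_sub]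
  gcongr
  have h4 : 1 - 2 * (θ * L) ≤ Real.exp (-(2 * (θ * L))) := by
    linarith [Real.add_one_le_exp (-(2 * (θ * L)))]
  calc _ ≤ -(θ * (1 - 2 * (θ * L))) - -(θ * (1 - ε)) := by gcongr
    _ = _ := by rw [hθL, hθ]; field_simp; ring

end Tail
end

theorem euclNorm_sq {n : ℕ} (x : Fin n → ℝ) : euclNorm x ^ 2 = x ⬝ᵥ x := by
  rw [euclNorm, Real.sq_sqrt (Finset.sum_nonneg fun i _ => sq_nonneg _)]
  simp only [dotProduct, sq]

/-- leverage score sampling gives an ℓ₂-subspace embedding. Indices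
`i₁, …, i_s` are sampled i.i.d. from the distribution `q` (modeled by the `s`-fold
product of the probability measure `ν` on `Fin n` with `ν {i} = q i`), and `Y` is the
`s × k` matrix whose `j`-th row is the `i_j`-th row of `Z` rescaled by
`1/√(s·q_{i_j})`. -/
theorem stmt19 {n k : ℕ} (hk : 0 < k) (Z : Matrix (Fin n) (Fin k) ℝ) (hZ : Zᵀ * Z = 1)
    (β : ℝ) (hβ0 : 0 < β) (hβ1 : β ≤ 1)
    (q : Fin n → ℝ) (hq0 : ∀ i, 0 ≤ q i) (hq1 : ∑ i, q i = 1)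
    (hqp : ∀ i : Fin n, β * (euclNorm (Z i) ^ 2 / k) ≤ q i)
    (ε δ : ℝ) (hε0 : 0 < ε) (hε1 : ε < 1) (hδ0 : 0 < δ) (hδ1 : δ < 1)
    (s : ℕ) (hs : (s : ℝ) > 144 * k * Real.log (2 * k / δ) / (β * ε ^ 2))
    (ν : Measure (Fin n)) [IsProbabilityMeasure ν]
    (hν : ∀ i : Fin n, ν {i} = ENNReal.ofReal (q i)) :
    (Measure.pi fun _ : Fin s => ν)
      {ω | ∀ x : Fin k → ℝ,
        (1 - ε) * euclNorm x ^ 2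
            ≤ euclNorm ((Matrix.of fun (j : Fin s) (l : Fin k) =>
                if 0 < q (ω j) then Z (ω j) l / Real.sqrt (s * q (ω j)) else 0).mulVec x) ^ 2 ∧
        euclNorm ((Matrix.of fun (j : Fin s) (l : Fin k) =>
                if 0 < q (ω j) then Z (ω j) l / Real.sqrt (s * q (ω j)) else 0).mulVec x) ^ 2
            ≤ (1 + ε) * euclNorm x ^ 2}
      ≥ ENNReal.ofReal (1 - δ) := by
  set r : Fin n → Fin k → ℝ := fun i l =>
    if 0 < q i then Z i l / Real.sqrt (s * q i) else 0 with hr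
  have hkR : (1 : ℝ) ≤ k := by exact_mod_cast hk
  have hlog : 0 < Real.log (2 * k / δ) := Real.log_pos (by rw [lt_div_iff₀ hδ0]; linarith)
  have hsR : (0 : ℝ) < s := lt_trans (by positivity) hs
  have hs0 : 0 < s := by exact_mod_cast hsR
  set L : ℝ := k / (β * s) with hL
  have hL0 : 0 < L := by positivity
  have hZq : ∀ i, Z i ⬝ᵥ Z i ≤ k / β * q i := by
    intro i
    have h := hqp i
    rw [euclNorm_sq] at h
    calc Z i ⬝ᵥ Z i = k / β * (β * (Z i ⬝ᵥ Z i / k)) := by field_simp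
      _ ≤ _ := by gcongr
  have hrL : ∀ i, r i ⬝ᵥ r i ≤ L := by
    intro i
    by_cases hi : 0 < q i
    · have e : r i ⬝ᵥ r i = (Z i ⬝ᵥ Z i) / (s * q i) := by
        simp only [hr, hi, if_true, dotProduct, Finset.sum_div]
        refine Finset.sum_congr rfl fun l _ => ?_
        rw [div_mul_div_comm, Real.mul_self_sqrt (by positivity)]
      rw [e, div_le_iff₀ (by positivity)]
      refine (hZq i).trans (le_of_eq ?_)
      rw [hL]; field_simp
    · have e : r i = 0 := by ext l; simp [hr, hi]
      simpa [e] using hL0.le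
  have hiso : ∑ i, q i • vecMulVec (r i) (r i) = (1 / s : ℝ) • (1 : Matrix (Fin k) (Fin k) ℝ) := by
    have h : ∀ i, q i • vecMulVec (r i) (r i) = (1 / s : ℝ) • vecMulVec (Z i) (Z i) := by
      intro i
      ext l m
      by_cases hi : 0 < q i
      · simp only [hr, hi, if_true, Matrix.smul_apply, vecMulVec_apply, smul_eq_mul]
        rw [div_mul_div_comm, Real.mul_self_sqrt (by positivity)]
        field_simp
      · have hqi : q i = 0 := le_antisymm (not_lt.1 hi) (hq0 i)
        have hZi : Z i = 0 := by
          refine dotProduct_self_eq_zero.1 (le_antisymm ?_ ?_)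
          · simpa [hqi] using hZq i
          · simpa using dotProduct_star_self_nonneg (Z i)
        simp [hqi, hZi, vecMulVec_apply]
    rw [Finset.sum_congr rfl fun i _ => h i, ← Finset.smul_sum, ← hZ]
    congr 1
    ext l m
    simp [Matrix.sum_apply, vecMulVec_apply, mul_apply]
  have htail : (k : ℝ) * Real.exp (-(ε ^ 2 / (8 * L))) ≤ δ / 2 := by
    have h1 : Real.log (2 * k / δ) ≤ ε ^ 2 / (8 * L) := by
      rw [gt_iff_lt, div_lt_iff₀ (by positivity)] at hs
      rw [le_div_iff₀ (by positivity), hL]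
      have h2 : Real.log (2 * k / δ) * (8 * (k / (β * s)))
          = 8 * k * Real.log (2 * k / δ) / (β * s) := by ring
      rw [h2, div_le_iff₀ (by positivity)]
      nlinarith [mul_pos (zero_lt_one.trans_le hkR) hlog]
    calc _ ≤ (k : ℝ) * Real.exp (-Real.log (2 * k / δ)) := by gcongr
      _ = δ / 2 := by
        rw [Real.exp_neg, Real.exp_log (by positivity)]
        field_simp
  have hup := measureReal_pi_lt_quadForm_le ν hq0 hq1 hν hs0 hL0 hrL hiso hε0 hε1
  have hlo := measureReal_pi_quadForm_lt_le ν hq0 hq1 hν hs0 hL0 hrL hiso hε0 hε1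
  rw [Fintype.card_fin] at hup hlo
  set μ := Measure.pi fun _ : Fin s => ν
  have hY : ∀ (ω : Fin s → Fin n) (x : Fin k → ℝ),
      euclNorm ((Matrix.of fun (j : Fin s) (l : Fin k) => r (ω j) l).mulVec x) ^ 2
        = ∑ j, (r (ω j) ⬝ᵥ x) ^ 2 := by
    intro ω x
    rw [euclNorm_sq]
    simp only [dotProduct, mulVec, of_apply, sq]
  change μ {ω | ∀ x : Fin k → ℝ, (1 - ε) * euclNorm x ^ 2
      ≤ euclNorm ((Matrix.of fun (j : Fin s) (l : Fin k) => r (ω j) l).mulVec x) ^ 2 ∧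
      euclNorm ((Matrix.of fun (j : Fin s) (l : Fin k) => r (ω j) l).mulVec x) ^ 2
        ≤ (1 + ε) * euclNorm x ^ 2} ≥ _
  simp only [hY, euclNorm_sq]
  set G := {ω : Fin s → Fin n | ∀ x : Fin k → ℝ,
    (1 - ε) * (x ⬝ᵥ x) ≤ ∑ j, (r (ω j) ⬝ᵥ x) ^ 2 ∧
      ∑ j, (r (ω j) ⬝ᵥ x) ^ 2 ≤ (1 + ε) * (x ⬝ᵥ x)}
  have hGc : μ.real Gᶜ ≤ δ := by
    refine (measureReal_mono (s₂ := {ω | ∃ x : Fin k → ℝ,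
      (1 + ε) * (x ⬝ᵥ x) < ∑ j, (r (ω j) ⬝ᵥ x) ^ 2} ∪ {ω | ∃ x : Fin k → ℝ,
      ∑ j, (r (ω j) ⬝ᵥ x) ^ 2 < (1 - ε) * (x ⬝ᵥ x)}) ?_).trans
      ((measureReal_union_le _ _).trans (by linarith))
    intro ω hω
    simp only [G, Set.mem_compl_iff, Set.mem_ofPred_eq, not_forall, not_and_or, not_le] at hω
    obtain ⟨x, hx | hx⟩ := hω
    · exact Or.inr ⟨x, hx⟩
    · exact Or.inl ⟨x, hx⟩
  rw [probReal_compl_eq_one_sub G.toFinite.measurableSet] at hGc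
  rw [ge_iff_le, ENNReal.ofReal_le_iff_le_toReal (measure_ne_top _ _)]
  rw [measureReal_def] at hGc
  linarith
end
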